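/- Let G be a (theta, prism)-free graph, let W = (H, c) be a non-special wheel in G such that the hole H has length at least seven, let S = N_H(c) and let T = N[c] ∪ (N[S] \ V(H)). Then for every vertex v ∈ V(G) \ (W ∪ T), there exists a sector P of W such that N_H(v) ⊆ V(P). -/

import Mathlib

open SimpleGraph

namespace Paper

variable {V : Type}

/-- Two vertex sets are anticomplete: no edges between them. -/
def Anticomplete (G : SimpleGraph V) (A B : Set V) : Prop :=
  ∀ a ∈ A, ∀ b ∈ B, ¬ G.Adj a b

/-- A stable (independent) set of vertices. -/
def StableSet (G : SimpleGraph V) (A : Set V) : Prop :=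
  ∀ x ∈ A, ∀ y ∈ A, x ≠ y → ¬ G.Adj x y

/-- A walk is induced in `G`: any two adjacent vertices on it are consecutive. -/
def InducedWalk (G : SimpleGraph V) {u v : V} (P : G.Walk u v) : Prop :=
  ∀ x ∈ P.support, ∀ y ∈ P.support, G.Adj x y → s(x, y) ∈ P.edges

/-- The interior (set of internal vertices) of a walk from `u` to `v`. -/
def Interior {G : SimpleGraph V} {u v : V} (P : G.Walk u v) : Set V :=
  {w | w ∈ P.support ∧ w ≠ u ∧ w ≠ v}

/-- Closed neighborhood of a set of vertices. -/
def ClosedNbhd (G : SimpleGraph V) (A : Set V) : Set V :=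
  A ∪ {v | ∃ a ∈ A, G.Adj v a}

/-- Open neighborhood of a set of vertices. -/
def OpenNbhd (G : SimpleGraph V) (A : Set V) : Set V :=
  {v | v ∉ A ∧ ∃ a ∈ A, G.Adj v a}

/-- `M` separates `x` and `y` in `G`: there is a separation `(L, M, R)` with `x ∈ L`, `y ∈ R`. -/
def Separates (G : SimpleGraph V) (M : Set V) (x y : V) : Prop :=
  ∃ L R : Set V,
    L ∪ M ∪ R = Set.univ ∧
    Disjoint L M ∧ Disjoint L R ∧ Disjoint M R ∧
    L.Nonempty ∧ R.Nonempty ∧ Anticomplete G L R ∧ x ∈ L ∧ y ∈ R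

/-- `G` contains a theta as an induced subgraph. -/
def ContainsTheta (G : SimpleGraph V) : Prop :=
  ∃ (a b : V) (P₁ P₂ P₃ : G.Walk a b),
    a ≠ b ∧ ¬ G.Adj a b ∧
    P₁.IsPath ∧ P₂.IsPath ∧ P₃.IsPath ∧
    InducedWalk G P₁ ∧ InducedWalk G P₂ ∧ InducedWalk G P₃ ∧
    2 ≤ P₁.length ∧ 2 ≤ P₂.length ∧ 2 ≤ P₃.length ∧
    Disjoint (Interior P₁) (Interior P₂) ∧
    Disjoint (Interior P₁) (Interior P₃) ∧
    Disjoint (Interior P₂) (Interior P₃) ∧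
    Anticomplete G (Interior P₁) (Interior P₂) ∧
    Anticomplete G (Interior P₁) (Interior P₃) ∧
    Anticomplete G (Interior P₂) (Interior P₃)

/-- `G` contains a prism as an induced subgraph (one path may have length zero). -/
def ContainsPrism (G : SimpleGraph V) : Prop :=
  ∃ (a b : Fin 3 → V) (P : ∀ i, G.Walk (a i) (b i)),
    (∀ i j, i ≠ j → G.Adj (a i) (a j)) ∧
    (∀ i j, i ≠ j → G.Adj (b i) (b j)) ∧
    (∀ i, (P i).IsPath) ∧ (∀ i, InducedWalk G (P i)) ∧
    (∀ i j, i ≠ j → ∀ x, x ∈ (P i).support → x ∉ (P j).support) ∧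
    (∀ i j, i ≠ j → ∀ x ∈ (P i).support, ∀ y ∈ (P j).support,
        G.Adj x y → (x = a i ∧ y = a j) ∨ (x = b i ∧ y = b j)) ∧
    (∀ i j, i ≠ j → 2 ≤ (P i).length + (P j).length)

/-- `G` contains `K_{1,t}` as an induced subgraph. -/
def ContainsK1t (G : SimpleGraph V) (t : ℕ) : Prop :=
  ∃ (v : V) (S : Finset V),
    S.card = t ∧ v ∉ S ∧ (∀ x ∈ S, G.Adj v x) ∧ StableSet G ↑S

/-- `G` belongs to the class `C_t` of (theta, prism, `K_{1,t}`)-free graphs. -/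
def MemCt (t : ℕ) (G : SimpleGraph V) : Prop :=
  ¬ ContainsTheta G ∧ ¬ ContainsPrism G ∧ ¬ ContainsK1t G t

/-- A tree decomposition of `G`. -/
structure TreeDecomp (G : SimpleGraph V) where
  ι : Type
  T : SimpleGraph ι
  isTree : T.IsTree
  bag : ι → Set V
  mem_bag : ∀ v : V, ∃ i, v ∈ bag i
  edge_bag : ∀ u v : V, G.Adj u v → ∃ i, u ∈ bag i ∧ v ∈ bag i
  bag_connected : ∀ v : V, (T.induce {i | v ∈ bag i}).Connected

/-- The tree independence number of `G` is at most `k`. -/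
def TreeAlphaLE (G : SimpleGraph V) (k : ℕ) : Prop :=
  ∃ D : TreeDecomp G, ∀ i : D.ι, ∀ S : Finset V,
    ↑S ⊆ D.bag i → StableSet G ↑S → S.card ≤ k

/-- Sum of weights over a vertex set. -/
noncomputable def wSum [Fintype V] (w : V → ℝ) (A : Set V) : ℝ :=
  ∑ v, A.indicator w v

/-- `D` is a connected component of `G \ X`. -/
def IsComponentOf (G : SimpleGraph V) (X D : Set V) : Prop :=
  D.Nonempty ∧ D ⊆ Xᶜ ∧ (G.induce D).Connected ∧
  ∀ D' : Set V, D ⊆ D' → D' ⊆ Xᶜ → (G.induce D').Connected → D' = D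

/-- `X` is a `w`-balanced separator in `G`. -/
def BalancedSeparator [Fintype V] (G : SimpleGraph V) (w : V → ℝ) (X : Set V) : Prop :=
  ∀ D : Set V, IsComponentOf G X D → wSum w D ≤ 1 / 2

/-- A closed walk is a hole (induced cycle of length at least four) in `G`. -/
def IsHoleWalk (G : SimpleGraph V) {h : V} (H : G.Walk h h) : Prop :=
  H.IsCycle ∧ 4 ≤ H.length ∧ InducedWalk G H

/-- The neighbors of `c` on the hole `H`. -/
def HoleNbrs (G : SimpleGraph V) {h : V} (H : G.Walk h h) (c : V) : Set V :=
  {v | v ∈ H.support ∧ G.Adj c v}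

/-- `(H, c)` is a wheel in `G`. -/
def IsWheel (G : SimpleGraph V) {h : V} (H : G.Walk h h) (c : V) : Prop :=
  IsHoleWalk G H ∧ c ∉ H.support ∧ 3 ≤ (HoleNbrs G H c).ncard

/-- `P` is a sector of the wheel `(H, c)`. -/
def IsSector (G : SimpleGraph V) {h : V} (H : G.Walk h h) (c : V)
    {x y : V} (P : G.Walk x y) : Prop :=
  P.IsPath ∧ 0 < P.length ∧
  (∀ w ∈ P.support, w ∈ H.support) ∧
  (∀ e ∈ P.edges, e ∈ H.edges) ∧
  G.Adj c x ∧ G.Adj c y ∧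
  ∀ w ∈ P.support, w ≠ x → w ≠ y → ¬ G.Adj c w

/-- The wheel `(H, c)` is special. -/
def IsSpecialWheel (G : SimpleGraph V) {h : V} (H : G.Walk h h) (c : V) : Prop :=
  IsWheel G H c ∧ ∃ a b d : V,
    a ≠ b ∧ a ≠ d ∧ b ≠ d ∧
    HoleNbrs G H c = {a, b, d} ∧
    s(a, b) ∈ H.edges ∧ s(a, d) ∉ H.edges ∧ s(b, d) ∉ H.edges

/-- `Z(W)` for a non-special wheel `W = (H, c)`. -/
def ZNonSpecial (G : SimpleGraph V) {h : V} (H : G.Walk h h) (c : V) : Set V :=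
  {c} ∪ HoleNbrs G H c

/-- `Z(W)` for a special wheel `W = (H, c)` with length-one sector `ab` and third neighbor `d`. -/
def ZSpecial (G : SimpleGraph V) {h : V} (H : G.Walk h h) (c a b d : V) : Set V :=
  ({a, b, c, d} : Set V) ∪ {v | s(v, d) ∈ H.edges}

/-- A pyramid in `G` with apex `apx`, base `b 0, b 1, b 2` and paths `P i`. -/
def IsPyramid (G : SimpleGraph V) (apx : V) (b : Fin 3 → V)
    (P : ∀ i, G.Walk apx (b i)) : Prop :=
  (∀ i, b i ≠ apx) ∧
  (∀ i j, i ≠ j → G.Adj (b i) (b j)) ∧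
  (∀ i, (P i).IsPath) ∧ (∀ i, InducedWalk G (P i)) ∧
  (∀ i, 1 ≤ (P i).length) ∧
  (∀ i j, i ≠ j → ∀ x, x ∈ (P i).support → x ∈ (P j).support → x = apx) ∧
  (∀ i j, i ≠ j → ∀ x ∈ (P i).support, ∀ y ∈ (P j).support,
      x ≠ apx → y ≠ apx → G.Adj x y → x = b i ∧ y = b j) ∧
  (∀ i j, i ≠ j → 3 ≤ (P i).length + (P j).length)

/-- `Z(Σ)` for a pyramid. -/
def ZPyramid (G : SimpleGraph V) (apx : V) (b : Fin 3 → V)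
    (P : ∀ i, G.Walk apx (b i)) : Set V :=
  {apx} ∪ {v | (∃ i, v ∈ (P i).support) ∧ G.Adj apx v} ∪ Set.range b

/-- `x : Fin k → V` enumerates `X` in an order witnessing that `(P, X)` is an alignment. -/
def AlignmentOrder (G : SimpleGraph V) {p q : V} (P : G.Walk p q)
    (X : Finset V) {k : ℕ} (x : Fin k → V) : Prop :=
  Function.Injective x ∧ (∀ l, x l ∈ X) ∧ (∀ z ∈ X, ∃ l, x l = z) ∧
  ∃ lo hi : Fin k → ℕ,
    (∀ l, lo l ≤ hi l) ∧
    (∀ l m : Fin k, l < m → hi l < lo m) ∧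
    (∀ l, hi l < P.support.length) ∧
    ∀ (l : Fin k) (n : Fin P.support.length),
      G.Adj (x l) (P.support.get n) → lo l ≤ (n : ℕ) ∧ (n : ℕ) ≤ hi l

/-- `(P, X)` is an alignment. -/
def IsAlignment (G : SimpleGraph V) {p q : V} (P : G.Walk p q) (X : Finset V) : Prop :=
  (∀ z ∈ X, z ∉ P.support) ∧
  (∀ z ∈ X, ∃ u ∈ P.support, G.Adj z u) ∧
  ∃ (k : ℕ) (x : Fin k → V), AlignmentOrder G P X x

/-- Every vertex of `X` has two non-adjacent neighbors in `P`. -/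
def WideAl (G : SimpleGraph V) {p q : V} (P : G.Walk p q) (X : Finset V) : Prop :=
  ∀ z ∈ X, ∃ u v : V, u ∈ P.support ∧ v ∈ P.support ∧
    G.Adj z u ∧ G.Adj z v ∧ u ≠ v ∧ ¬ G.Adj u v

/-- Every vertex of `X` has a unique neighbor in `P`. -/
def SpikyAl (G : SimpleGraph V) {p q : V} (P : G.Walk p q) (X : Finset V) : Prop :=
  ∀ z ∈ X, ∃! u : V, u ∈ P.support ∧ G.Adj z u

/-- Every vertex of `X` has exactly two neighbors in `P`, and they are adjacent. -/
def TriangularAl (G : SimpleGraph V) {p q : V} (P : G.Walk p q) (X : Finset V) : Prop :=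
  ∀ z ∈ X, ∃ u v : V, u ∈ P.support ∧ v ∈ P.support ∧
    G.Adj z u ∧ G.Adj z v ∧ u ≠ v ∧ G.Adj u v ∧
    ∀ w ∈ P.support, G.Adj z w → w = u ∨ w = v

/-- `(P, X)` is a consistent alignment. -/
def ConsistentAlignment (G : SimpleGraph V) {p q : V} (P : G.Walk p q) (X : Finset V) : Prop :=
  IsAlignment G P X ∧ (WideAl G P X ∨ SpikyAl G P X ∨ TriangularAl G P X)

/-- A branch vertex of a graph: a vertex of degree at least three. -/
def BranchVtx {W : Type} (T : SimpleGraph W) (v : W) : Prop :=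
  3 ≤ (T.neighborSet v).ncard

/-- `T` is a caterpillar: a tree of maximum degree three, no two branch vertices adjacent,
and some path contains all branch vertices. -/
def IsCaterpillar {W : Type} (T : SimpleGraph W) : Prop :=
  T.IsTree ∧ (∀ v, (T.neighborSet v).ncard ≤ 3) ∧
  (∀ u v, BranchVtx T u → BranchVtx T v → ¬ T.Adj u v) ∧
  ∃ (x y : W) (P : T.Walk x y), P.IsPath ∧ ∀ v, BranchVtx T v → v ∈ P.support

/-- `T` is a subdivided star with root `r`. -/
def IsSubdividedStar {W : Type} (T : SimpleGraph W) (r : W) : Prop :=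
  T.IsTree ∧ 3 ≤ (T.neighborSet r).ncard ∧ ∀ v, v ≠ r → (T.neighborSet v).ncard ≤ 2

/-- `H` is isomorphic to the line graph of a caterpillar. -/
def IsLineCaterpillar {U : Type} (H : SimpleGraph U) : Prop :=
  ∃ (W : Type) (T : SimpleGraph W), IsCaterpillar T ∧ Nonempty (H ≃g T.lineGraph)

/-- `H` is isomorphic to the line graph of a subdivided star. -/
def IsLineSubdividedStar {U : Type} (H : SimpleGraph U) : Prop :=
  ∃ (W : Type) (T : SimpleGraph W) (r : W),
    IsSubdividedStar T r ∧ Nonempty (H ≃g T.lineGraph)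

/-- `v` is a simplicial vertex of `G[S]`. -/
def SimplicialIn (G : SimpleGraph V) (S : Set V) (v : V) : Prop :=
  v ∈ S ∧ ∀ u ∈ S, ∀ w ∈ S, G.Adj v u → G.Adj v w → u ≠ w → G.Adj u w

/-- `G[S]` is one of the four connectifier shapes. -/
def ConnType (G : SimpleGraph V) (S : Set V) : Prop :=
  IsCaterpillar (G.induce S) ∨ IsLineCaterpillar (G.induce S) ∨
  (∃ r, IsSubdividedStar (G.induce S) r) ∨ IsLineSubdividedStar (G.induce S)

/-- `(G[S], X)` is a connectifier. -/
def IsConnectifier (G : SimpleGraph V) (S : Set V) (X : Finset V) : Prop :=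
  (∀ z ∈ X, (z : V) ∉ S) ∧ (∀ z ∈ X, ∃ r ∈ S, G.Adj z r) ∧
  ( (∃ v, S = {v}) ∨
    ( ConnType G S ∧
      (∀ z ∈ X, ∀ r₁ ∈ S, ∀ r₂ ∈ S, G.Adj z r₁ → G.Adj z r₂ → r₁ = r₂) ∧
      (∀ z ∈ X, ∀ r ∈ S, G.Adj z r → SimplicialIn G S r) ∧
      (∀ v, SimplicialIn G S v → ∃ z ∈ X, G.Adj z v) ) )

/-- The connectifier `(G[S], X)` is concentrated. -/
def Concentrated (G : SimpleGraph V) (S : Set V) : Prop :=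
  (∃ v, S = {v}) ∨ (∃ r, IsSubdividedStar (G.induce S) r) ∨
  IsLineSubdividedStar (G.induce S)

/-- Reachability inside a vertex set `A`. -/
def Reaches (G : SimpleGraph V) (A : Set V) (u v : V) : Prop :=
  ∃ (w : G.Walk u v), ∀ z ∈ w.support, z ∈ A

/-- `Pw` is a spine of the caterpillar `G[S]`: a maximal path containing all branch vertices. -/
def IsSpineOf (G : SimpleGraph V) (S : Set V) {p q : V} (Pw : G.Walk p q) : Prop :=
  Pw.IsPath ∧ (∀ w ∈ Pw.support, w ∈ S) ∧
  (∀ v ∈ S, 3 ≤ ({u | u ∈ S ∧ G.Adj v u}).ncard → v ∈ Pw.support) ∧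
  ∀ (p' q' : V) (P' : G.Walk p' q'), P'.IsPath → (∀ w ∈ P'.support, w ∈ S) →
    (∀ w ∈ Pw.support, w ∈ P'.support) → ∀ w ∈ P'.support, w ∈ Pw.support

/-- `Pw` realizes `P(H)` for `H = G[S]`, when `H` is a caterpillar or the line graph
of a caterpillar. -/
def IsPHOf (G : SimpleGraph V) (S : Set V) {p q : V} (Pw : G.Walk p q) : Prop :=
  Pw.IsPath ∧ (∀ w ∈ Pw.support, w ∈ S) ∧
  ( (IsCaterpillar (G.induce S) ∧ IsSpineOf G S Pw) ∨
    (∃ (W : Type) (T : SimpleGraph W) (φ : T.lineGraph ≃g G.induce S)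
        (x y : W) (Q : T.Walk x y),
      IsCaterpillar T ∧ Q.IsPath ∧
      (∀ v, BranchVtx T v → v ∈ Q.support) ∧
      (∀ (x' y' : W) (Q' : T.Walk x' y'), Q'.IsPath →
        (∀ w ∈ Q.support, w ∈ Q'.support) → ∀ w ∈ Q'.support, w ∈ Q.support) ∧
      {w | w ∈ Pw.support} = {v : V | ∃ e : T.edgeSet, (e : Sym2 W) ∈ Q.edges ∧ ↑(φ e) = v}) )

/-- `x` enumerates `X` in the order given by the (non-concentrated) connectifier `(G[S], X)`
with central path `Pw = P(H)`. -/
def ConnectifierOrder (G : SimpleGraph V) (S : Set V) (X : Finset V)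
    {p q : V} (Pw : G.Walk p q) {k : ℕ} (x : Fin k → V) : Prop :=
  Function.Injective x ∧ (∀ l, x l ∈ X) ∧ (∀ z ∈ X, ∃ l, x l = z) ∧
  ∃ (s : Fin k → V) (lo hi : Fin k → ℕ),
    (∀ l, lo l ≤ hi l) ∧ (∀ l m : Fin k, l < m → hi l < lo m) ∧
    (∀ l, hi l < Pw.support.length) ∧
    (∀ (l : Fin k) (n : Fin Pw.support.length),
      G.Adj (s l) (Pw.support.get n) → lo l ≤ (n : ℕ) ∧ (n : ℕ) ≤ hi l) ∧
    ∀ l : Fin k, s l ∈ S ∧ s l ∉ Pw.support ∧ (∃ u ∈ Pw.support, G.Adj (s l) u) ∧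
      ∀ r ∈ S, G.Adj (x l) r → Reaches G (S \ {w | w ∈ Pw.support}) r (s l)

/-- `(G[S], X)` is a consistent alignment (with `G[S]` a path). -/
def ConsistentAlignmentSet (G : SimpleGraph V) (S : Set V) (X : Finset V) : Prop :=
  ∃ (p q : V) (Pw : G.Walk p q), Pw.IsPath ∧ InducedWalk G Pw ∧
    {w | w ∈ Pw.support} = S ∧ ConsistentAlignment G Pw X

/-- The orders on `X` given by `(D1, X)` and by `(G[S], X)` coincide. -/
def OrdersAgree (G : SimpleGraph V) {p q : V} (D1w : G.Walk p q)
    (S : Set V) (X : Finset V) : Prop :=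
  ∃ (k : ℕ) (x : Fin k → V),
    AlignmentOrder G D1w X x ∧
    ( (∃ (p' q' : V) (Pw : G.Walk p' q'), IsPHOf G S Pw ∧ ConnectifierOrder G S X Pw x) ∨
      (∃ (p' q' : V) (Pw : G.Walk p' q'), Pw.IsPath ∧ InducedWalk G Pw ∧
        {w | w ∈ Pw.support} = S ∧ AlignmentOrder G Pw X x) )

/-- `(D1, Y, D2)` is an `s`-trisection of `G`, where `D1` is (the support of) the path `D1w`. -/
def IsTrisection (G : SimpleGraph V) (s : ℕ) {p q : V} (D1w : G.Walk p q)
    (Y D2 : Set V) : Prop :=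
  D1w.IsPath ∧ InducedWalk G D1w ∧
  (∀ w ∈ D1w.support, w ∉ Y ∧ w ∉ D2) ∧ Disjoint Y D2 ∧
  ({w | w ∈ D1w.support} ∪ Y ∪ D2 = Set.univ) ∧
  D2.Nonempty ∧
  (∀ a ∈ D1w.support, ∀ b ∈ D2, ¬ G.Adj a b) ∧
  StableSet G Y ∧ Y.ncard = s ∧
  OpenNbhd G {w | w ∈ D1w.support} = Y ∧ OpenNbhd G D2 = Y ∧
  (∀ y ∈ Y, ∃ d ∈ D1w.support, ∀ z ∈ Y, (G.Adj d z ↔ z = y))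

/-- The conclusion of amiability for the trisection `(D1w, Y, D2)` with parameter `x`:
the pair `(G[S], X)` is "given by amiability". -/
def AmiableOutcome (G : SimpleGraph V) {p q : V} (D1w : G.Walk p q)
    (Y D2 : Set V) (x : ℕ) (S : Set V) (X : Finset V) : Prop :=
  S ⊆ D2 ∧ ↑X ⊆ Y ∧ X.card = x ∧
  ConsistentAlignment G D1w X ∧
  (IsConnectifier G S X ∨ ConsistentAlignmentSet G S X) ∧
  (¬ (IsConnectifier G S X ∧ Concentrated G S) → OrdersAgree G D1w S X)


/-- Two vertex sets are apart: disjoint and anticomplete. -/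
def Apart (G : SimpleGraph V) (A B : Set V) : Prop :=
  Disjoint A B ∧ Anticomplete G A B

/-- There is a route from `a` to `b` whose internal vertices all lie in `A`. -/
def LinkedThrough (G : SimpleGraph V) (A : Set V) (a b : V) : Prop :=
  ∃ x y, G.Adj a x ∧ Reaches G A x y ∧ G.Adj y b

lemma Apart.symm {G : SimpleGraph V} {A B : Set V} (h : Apart G A B) : Apart G B A :=
  ⟨h.1.symm, fun b hb a ha hab => h.2 a ha b hb hab.symm⟩

lemma Apart.insert_left {G : SimpleGraph V} {A B : Set V} {x : V} (h : Apart G A B)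
    (hx : x ∉ B) (hxB : ∀ b ∈ B, ¬ G.Adj x b) : Apart G (insert x A) B := by
  refine ⟨Set.disjoint_insert_left.2 ⟨hx, h.1⟩, ?_⟩
  rintro a (rfl | ha) b hb
  · exact hxB b hb
  · exact h.2 a ha b hb

lemma Reaches.refl {G : SimpleGraph V} {A : Set V} {u : V} (hu : u ∈ A) : Reaches G A u u :=
  ⟨Walk.nil, by simpa using hu⟩

lemma Reaches.mono {G : SimpleGraph V} {A B : Set V} {u w : V} (hAB : A ⊆ B)
    (h : Reaches G A u w) : Reaches G B u w := by
  obtain ⟨p, hp⟩ := h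
  exact ⟨p, fun z hz => hAB (hp z hz)⟩

lemma Reaches.symm {G : SimpleGraph V} {A : Set V} {u w : V} (h : Reaches G A u w) :
    Reaches G A w u := by
  obtain ⟨p, hp⟩ := h
  exact ⟨p.reverse, fun z hz => hp z (by simpa using hz)⟩

lemma Reaches.cons {G : SimpleGraph V} {A : Set V} {u w z : V} (hu : u ∈ A) (huw : G.Adj u w)
    (h : Reaches G A w z) : Reaches G A u z := by
  obtain ⟨p, hp⟩ := h
  refine ⟨Walk.cons huw p, fun y hy => ?_⟩
  rcases List.mem_cons.1 (by simpa using hy) with rfl | hy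
  · exact hu
  · exact hp y hy

lemma Reaches.exists_induced_path {G : SimpleGraph V} {A : Set V} {u w : V}
    (h : Reaches G A u w) :
    ∃ p : G.Walk u w, p.IsPath ∧ InducedWalk G p ∧ ∀ z ∈ p.support, z ∈ A := by
  classical
  have hex : ∃ n, ∃ p : G.Walk u w, (∀ z ∈ p.support, z ∈ A) ∧ p.length = n := by
    obtain ⟨p, hp⟩ := h
    exact ⟨_, p, hp, rfl⟩
  obtain ⟨p, hpA, hpn⟩ := Nat.find_spec hex
  have hmin : ∀ q : G.Walk u w, (∀ z ∈ q.support, z ∈ A) → p.length ≤ q.length := by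
    intro q hq
    rw [hpn]
    exact Nat.find_min' hex ⟨q, hq, rfl⟩
  have hshort : ∀ i j, i < j → j ≤ p.length → G.Adj (p.getVert i) (p.getVert j) →
      j = i + 1 := by
    intro i j hij hj hadj
    by_contra hne
    have := hmin ((p.take i).append (Walk.cons hadj (p.drop j))) (by
      intro z hz
      rw [Walk.mem_support_append_iff] at hz
      apply hpA
      rcases hz with hz | hz
      · rw [Walk.support_take] at hz
        exact List.mem_of_mem_take hz
      · rw [Walk.support_cons, List.mem_cons] at hz
        rcases hz with rfl | hz
        · exact p.getVert_mem_support i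
        · rw [Walk.drop_support_eq_support_drop_min] at hz
          exact List.mem_of_mem_drop hz)
    rw [Walk.length_append, Walk.length_cons, Walk.take_length, Walk.drop_length] at this
    omega
  refine ⟨p, ?_, ?_, hpA⟩
  · have hle : p.length ≤ p.bypass.length :=
      hmin p.bypass fun z hz => hpA z (p.support_bypass_subset_support hz)
    rw [← p.bypass_eq_self_of_length_le_length_bypass hle]
    exact p.bypass_isPath
  · intro x hx y hy hxy
    obtain ⟨i, rfl, hi⟩ := Walk.mem_support_iff_exists_getVert.1 hx
    obtain ⟨j, rfl, hj⟩ := Walk.mem_support_iff_exists_getVert.1 hy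
    rw [← Walk.adj_toSubgraph_iff_mem_edges]
    rcases lt_trichotomy i j with hij | rfl | hij
    · obtain rfl := hshort i j hij hj hxy
      exact p.toSubgraph_adj_getVert (by omega)
    · exact (G.loopless.irrefl _ hxy).elim
    · obtain rfl := hshort j i hij hi hxy.symm
      exact (p.toSubgraph_adj_getVert (by omega)).symm

lemma two_le_length {G : SimpleGraph V} {a b : V} (hab : a ≠ b) (hnab : ¬ G.Adj a b)
    (p : G.Walk a b) : 2 ≤ p.length := by
  by_contra hlt
  have : p.length = 0 ∨ p.length = 1 := by omega
  rcases this with h0 | h1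
  · exact hab (Walk.eq_of_length_eq_zero h0)
  · exact hnab (Walk.adj_of_length_eq_one h1)

lemma LinkedThrough.exists_path {G : SimpleGraph V} {A : Set V} {a b : V}
    (h : LinkedThrough G A a b) :
    ∃ p : G.Walk a b, p.IsPath ∧ InducedWalk G p ∧ Interior p ⊆ A := by
  obtain ⟨x, y, hax, hxy, hyb⟩ := h
  have hr : Reaches G (insert a (insert b A)) a b := by
    refine Reaches.cons (by simp) hax (Reaches.symm (Reaches.cons (by simp) hyb.symm ?_))
    exact hxy.symm.mono ((Set.subset_insert _ _).trans (Set.subset_insert _ _))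
  obtain ⟨p, hp, hi, hs⟩ := hr.exists_induced_path
  refine ⟨p, hp, hi, fun w hw => ?_⟩
  rcases hs w hw.1 with h1 | h1 | h1
  · exact (hw.2.1 h1).elim
  · exact (hw.2.2 h1).elim
  · exact h1

lemma containsTheta_of_linkedThrough {G : SimpleGraph V} {a b : V} {A₁ A₂ A₃ : Set V}
    (hab : a ≠ b) (hnab : ¬ G.Adj a b) (h₁ : LinkedThrough G A₁ a b)
    (h₂ : LinkedThrough G A₂ a b) (h₃ : LinkedThrough G A₃ a b)
    (h₁₂ : Apart G A₁ A₂) (h₁₃ : Apart G A₁ A₃) (h₂₃ : Apart G A₂ A₃) : ContainsTheta G := by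
  obtain ⟨p₁, hp₁, hi₁, hs₁⟩ := h₁.exists_path
  obtain ⟨p₂, hp₂, hi₂, hs₂⟩ := h₂.exists_path
  obtain ⟨p₃, hp₃, hi₃, hs₃⟩ := h₃.exists_path
  exact ⟨a, b, p₁, p₂, p₃, hab, hnab, hp₁, hp₂, hp₃, hi₁, hi₂, hi₃, two_le_length hab hnab _,
    two_le_length hab hnab _, two_le_length hab hnab _, h₁₂.1.mono hs₁ hs₂, h₁₃.1.mono hs₁ hs₃,
    h₂₃.1.mono hs₂ hs₃, fun x hx y hy => h₁₂.2 x (hs₁ hx) y (hs₂ hy),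
    fun x hx y hy => h₁₃.2 x (hs₁ hx) y (hs₃ hy), fun x hx y hy => h₂₃.2 x (hs₂ hx) y (hs₃ hy)⟩

/-- Two triangles sharing the vertex `x`, joined by two further paths, form a prism. -/
lemma containsPrism_of_reaches {G : SimpleGraph V} {a₀ b₀ a₁ b₁ x : V} {A₀ A₁ : Set V}
    (h₀ : Reaches G A₀ a₀ b₀) (h₁ : Reaches G A₁ a₁ b₁) (hdis : Disjoint A₀ A₁)
    (hx₀ : x ∉ A₀) (hx₁ : x ∉ A₁)
    (hcross : ∀ u ∈ A₀, ∀ w ∈ A₁, G.Adj u w → u = a₀ ∧ w = a₁ ∨ u = b₀ ∧ w = b₁)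
    (hxA₀ : ∀ u ∈ A₀, G.Adj x u → u = a₀ ∨ u = b₀)
    (hxA₁ : ∀ u ∈ A₁, G.Adj x u → u = a₁ ∨ u = b₁)
    (ha : G.Adj a₀ a₁) (hb : G.Adj b₀ b₁) (hxa₀ : G.Adj x a₀) (hxa₁ : G.Adj x a₁)
    (hxb₀ : G.Adj x b₀) (hxb₁ : G.Adj x b₁)
    (hne₀ : a₀ ≠ b₀) (hn₀ : ¬ G.Adj a₀ b₀) (hne₁ : a₁ ≠ b₁) (hn₁ : ¬ G.Adj a₁ b₁) :
    ContainsPrism G := by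
  obtain ⟨p₀, hp₀, hi₀, hs₀⟩ := h₀.exists_induced_path
  obtain ⟨p₁, hp₁, hi₁, hs₁⟩ := h₁.exists_induced_path
  have hl₀ := two_le_length hne₀ hn₀ p₀
  have hl₁ := two_le_length hne₁ hn₁ p₁
  have hd : ∀ u ∈ p₀.support, u ∉ p₁.support := fun u hu hu' =>
    Set.disjoint_left.1 hdis (hs₀ u hu) (hs₁ u hu')
  refine ⟨![a₀, a₁, x], ![b₀, b₁, x], fun i => match i with
    | 0 => p₀
    | 1 => p₁
    | 2 => Walk.nil, ?_, ?_, ?_, ?_, ?_, ?_, ?_⟩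
  · intro i j hij
    fin_cases i <;> fin_cases j <;> simp_all [G.adj_comm]
  · intro i j hij
    fin_cases i <;> fin_cases j <;> simp_all [G.adj_comm]
  · intro i
    fin_cases i
    exacts [hp₀, hp₁, Walk.IsPath.nil]
  · intro i
    fin_cases i
    · exact hi₀
    · exact hi₁
    · intro y hy z hz hyz
      have hyx : y = x := Walk.mem_support_nil_iff.1 (show y ∈ (Walk.nil : G.Walk x x).support from hy)
      have hzx : z = x := Walk.mem_support_nil_iff.1 (show z ∈ (Walk.nil : G.Walk x x).support from hz)
      rw [hyx, hzx] at hyz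
      exact (G.loopless.irrefl _ hyz).elim
  · intro i j hij y hy hy'
    fin_cases i <;> fin_cases j <;> simp at hij hy hy'
    · exact hd _ hy hy'
    · exact hx₀ (hs₀ _ (hy' ▸ hy))
    · exact hd _ hy' hy
    · exact hx₁ (hs₁ _ (hy' ▸ hy))
    · exact hx₀ (hs₀ _ (hy ▸ hy'))
    · exact hx₁ (hs₁ _ (hy ▸ hy'))
  · intro i j hij y hy z hz hyz
    fin_cases i <;> fin_cases j <;> simp at hij hy hz ⊢
    · exact hcross _ (hs₀ _ hy) _ (hs₁ _ hz) hyz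
    · subst hz
      simpa using hxA₀ _ (hs₀ _ hy) hyz.symm
    · have := hcross _ (hs₀ _ hz) _ (hs₁ _ hy) hyz.symm
      tauto
    · subst hz
      simpa using hxA₁ _ (hs₁ _ hy) hyz.symm
    · subst hy
      simpa using hxA₀ _ (hs₀ _ hz) hyz
    · subst hy
      simpa using hxA₁ _ (hs₁ _ hz) hyz
  · intro i j hij
    fin_cases i <;> fin_cases j <;> simp at hij ⊢ <;> omega

/-- `f` is a periodic enumeration of a hole of length `n` in `G`. -/
structure CyclicHole (G : SimpleGraph V) (n : ℤ) (f : ℤ → V) : Prop where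
  four_le : 4 ≤ n
  periodic : ∀ i, f (i + n) = f i
  ne : ∀ i j, i < j → j < i + n → f i ≠ f j
  adj_iff : ∀ i j, i < j → j < i + n → (G.Adj (f i) (f j) ↔ j = i + 1 ∨ j + 1 = i + n)

/-- The vertices `f a, …, f b`. -/
def arc (f : ℤ → V) (a b : ℤ) : Set V := f '' Set.Icc a b

lemma mem_arc {f : ℤ → V} {a b i : ℤ} (ha : a ≤ i) (hb : i ≤ b) : f i ∈ arc f a b :=
  ⟨i, ⟨ha, hb⟩, rfl⟩

namespace CyclicHole

variable {G : SimpleGraph V} {n : ℤ} {f : ℤ → V}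

lemma adj_succ (hf : CyclicHole G n f) (i : ℤ) : G.Adj (f i) (f (i + 1)) :=
  (hf.adj_iff i (i + 1) (by omega) (by have := hf.four_le; omega)).2 (Or.inl rfl)

lemma adj_of_eq_add_one (hf : CyclicHole G n f) {i j : ℤ} (hij : j = i + 1) :
    G.Adj (f i) (f j) :=
  hij ▸ hf.adj_succ i

lemma not_adj (hf : CyclicHole G n f) {i j : ℤ} (hij : i + 2 ≤ j) (hji : j + 2 ≤ i + n) :
    ¬ G.Adj (f i) (f j) := by
  rw [hf.adj_iff i j (by omega) (by omega)]
  omega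

lemma reflect (hf : CyclicHole G n f) : CyclicHole G n fun i => f (-i) where
  four_le := hf.four_le
  periodic i := by
    rw [← hf.periodic (-(i + n))]
    congr 1
    ring
  ne i j hij hji := (hf.ne (-j) (-i) (by omega) (by omega)).symm
  adj_iff i j hij hji := by
    rw [G.adj_comm, hf.adj_iff (-j) (-i) (by omega) (by omega)]
    omega

lemma reaches_arc (hf : CyclicHole G n f) {a b : ℤ} (hab : a ≤ b) :
    Reaches G (arc f a b) (f a) (f b) := by
  induction b, hab using Int.leInduction with
  | base => exact Reaches.refl (mem_arc le_rfl le_rfl)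
  | succ b hab ih =>
    refine (Reaches.cons (mem_arc (by omega) le_rfl) (hf.adj_succ b).symm ?_).symm
    refine ih.symm.mono (Set.image_mono fun i hi => ?_)
    exact ⟨hi.1, hi.2.trans (by omega)⟩

lemma apart_arc (hf : CyclicHole G n f) {a b a' b' : ℤ} (h : b + 2 ≤ a') (h' : b' + 2 ≤ a + n) :
    Apart G (arc f a b) (arc f a' b') := by
  constructor
  · rw [Set.disjoint_left]
    rintro _ ⟨i, ⟨hi, hi'⟩, rfl⟩ ⟨j, ⟨hj, hj'⟩, hij⟩
    exact hf.ne i j (by omega) (by omega) hij.symm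
  · rintro _ ⟨i, ⟨hi, hi'⟩, rfl⟩ _ ⟨j, ⟨hj, hj'⟩, rfl⟩
    exact hf.not_adj (by omega) (by omega)

lemma notMem_arc {f : ℤ → V} {x : V} (hx : ∀ i, x ≠ f i) (a b : ℤ) : x ∉ arc f a b := by
  rintro ⟨i, -, rfl⟩
  exact hx i rfl

lemma linkedThrough_arc (hf : CyclicHole G n f) {a b i j : ℤ} {x y : V} (hab : a ≤ b)
    (hij : i = a ∧ j = b ∨ i = b ∧ j = a) (hx : G.Adj x (f i)) (hy : G.Adj y (f j)) :
    LinkedThrough G (arc f a b) x y := by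
  rcases hij with ⟨rfl, rfl⟩ | ⟨rfl, rfl⟩
  · exact ⟨_, _, hx, hf.reaches_arc hab, hy.symm⟩
  · exact ⟨_, _, hx, (hf.reaches_arc hab).symm, hy.symm⟩

/-- In a theta-free graph, a vertex outside a hole does not have exactly two neighbors in it that
are non-adjacent. -/
lemma exists_third_neighbor (hf : CyclicHole G n f) (hth : ¬ ContainsTheta G) {x : V}
    (hx : ∀ i, x ≠ f i) {i j : ℤ} (hij : i + 2 ≤ j) (hji : j + 2 ≤ i + n)
    (hi : G.Adj x (f i)) (hj : G.Adj x (f j)) :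
    ∃ k, i < k ∧ k < i + n ∧ k ≠ j ∧ G.Adj x (f k) := by
  by_contra! hno
  refine hth (containsTheta_of_linkedThrough (a := f i) (b := f j) (A₁ := {x})
    (A₂ := arc f (i + 1) (j - 1)) (A₃ := arc f (j + 1) (i + n - 1))
    (hf.ne i j (by omega) (by omega)) (hf.not_adj hij hji)
    ⟨x, x, hi.symm, Reaches.refl rfl, hj⟩ ?_ ?_ ?_ ?_ ?_)
  · exact hf.linkedThrough_arc (i := i + 1) (j := j - 1) (by omega) (Or.inl ⟨rfl, rfl⟩)
      (hf.adj_succ i) (hf.adj_of_eq_add_one (by omega)).symm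
  · refine hf.linkedThrough_arc (i := i + n - 1) (j := j + 1) (by omega) (Or.inr ⟨rfl, rfl⟩)
      ?_ (hf.adj_succ j)
    rw [← hf.periodic i]
    exact (hf.adj_of_eq_add_one (by omega)).symm
  · refine ⟨Set.disjoint_singleton_left.2 (notMem_arc hx _ _), ?_⟩
    rintro _ rfl _ ⟨k, ⟨hk, hk'⟩, rfl⟩
    exact hno k (by omega) (by omega) (by omega)
  · refine ⟨Set.disjoint_singleton_left.2 (notMem_arc hx _ _), ?_⟩
    rintro _ rfl _ ⟨k, ⟨hk, hk'⟩, rfl⟩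
    exact hno k (by omega) (by omega) (by omega)
  · exact hf.apart_arc (by omega) (by omega)

/-- In a prism-free graph, the neighborhood in a hole of a vertex outside it does not consist of
two edges at distance at least two. -/
lemma exists_fifth_neighbor (hf : CyclicHole G n f) (hpr : ¬ ContainsPrism G) {x : V}
    (hx : ∀ i, x ≠ f i) {i j : ℤ} (hij : i + 3 ≤ j) (hji : j + 3 ≤ i + n)
    (hi : G.Adj x (f i)) (hi' : G.Adj x (f (i + 1))) (hj : G.Adj x (f j))
    (hj' : G.Adj x (f (j + 1))) :
    ∃ k, i < k ∧ k < i + n ∧ k ≠ i + 1 ∧ k ≠ j ∧ k ≠ j + 1 ∧ G.Adj x (f k) := by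
  by_contra! hno
  have hr := (hf.reaches_arc (a := j + 1) (b := i + n) (by omega)).symm
  refine hpr (containsPrism_of_reaches (hf.reaches_arc (a := i + 1) (b := j) (by omega)) hr
    ?_ (notMem_arc hx _ _) (notMem_arc hx _ _) ?_ ?_ ?_ ?_ (hf.adj_succ j) hi' ?_ hj hj'
    (hf.ne _ _ (by omega) (by omega)) (hf.not_adj (by omega) (by omega))
    (hf.ne _ _ (by omega) (by omega)).symm
    fun h => hf.not_adj (by omega) (by omega) h.symm)
  · rw [Set.disjoint_left]
    rintro _ ⟨k, ⟨hk, hk'⟩, rfl⟩ ⟨l, ⟨hl, hl'⟩, hkl⟩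
    exact hf.ne k l (by omega) (by omega) hkl.symm
  · rintro _ ⟨k, ⟨hk, hk'⟩, rfl⟩ _ ⟨l, ⟨hl, hl'⟩, rfl⟩ hkl
    rw [hf.adj_iff k l (by omega) (by omega)] at hkl
    rcases hkl with h | h
    · obtain rfl : k = j := by omega
      exact Or.inr ⟨rfl, by rw [h]⟩
    · obtain rfl : k = i + 1 := by omega
      exact Or.inl ⟨rfl, by congr 1; omega⟩
  · rintro _ ⟨k, ⟨hk, hk'⟩, rfl⟩ hxk
    by_contra! hne
    exact hno k (by omega) (by omega) (fun h => hne.1 (by rw [h])) (fun h => hne.2 (by rw [h]))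
      (by omega) hxk
  · rintro _ ⟨k, ⟨hk, hk'⟩, rfl⟩ hxk
    by_contra! hne
    have h1 : k ≠ i + n := fun h => hne.1 (by rw [h])
    exact hno k (by omega) (by omega) (by omega) (by omega) (fun h => hne.2 (by rw [h])) hxk
  · rw [hf.periodic]
    exact (hf.adj_succ i).symm
  · rwa [hf.periodic]

end CyclicHole

/-- `c` and `v` are distinct non-adjacent vertices outside the hole enumerated by `f`, with no
common neighbor in it. -/
structure FarPair (G : SimpleGraph V) (f : ℤ → V) (c v : V) : Prop where
  ne : v ≠ c
  not_adj : ¬ G.Adj v c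
  left_ne : ∀ i, c ≠ f i
  right_ne : ∀ i, v ≠ f i
  disjoint : ∀ i, G.Adj c (f i) → ¬ G.Adj v (f i)

lemma FarPair.reflect {G : SimpleGraph V} {f : ℤ → V} {c v : V} (h : FarPair G f c v) :
    FarPair G (fun i => f (-i)) c v :=
  ⟨h.ne, h.not_adj, fun _ => h.left_ne _, fun _ => h.right_ne _, fun _ => h.disjoint _⟩

/-- `f a, …, f b` is a sector of `c` in which the first and last neighbors of `v` are `f p` and
`f q`. -/
structure HitSector (G : SimpleGraph V) (f : ℤ → V) (c v : V) (a p q b : ℤ) : Prop where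
  start_lt : a < p
  le : p ≤ q
  lt_end : q < b
  adj_start : G.Adj c (f a)
  adj_end : G.Adj c (f b)
  not_adj : ∀ i, a < i → i < b → ¬ G.Adj c (f i)
  adj_first : G.Adj v (f p)
  adj_last : G.Adj v (f q)
  first_le : ∀ i, a ≤ i → i ≤ b → G.Adj v (f i) → p ≤ i
  le_last : ∀ i, a ≤ i → i ≤ b → G.Adj v (f i) → i ≤ q

namespace HitSector

variable {G : SimpleGraph V} {n : ℤ} {f : ℤ → V} {c v : V} {a p q b a' p' q' b' : ℤ}

lemma shift (hf : CyclicHole G n f) (h : HitSector G f c v a p q b) :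
    HitSector G f c v (a + n) (p + n) (q + n) (b + n) := by
  have hper : ∀ i, f (i - n) = f i := fun i => by rw [← hf.periodic (i - n), sub_add_cancel]
  obtain ⟨h1, h2, h3, h4, h5, h6, h7, h8, h9, h10⟩ := h
  refine ⟨by omega, by omega, by omega, by rwa [hf.periodic], by rwa [hf.periodic], ?_,
    by rwa [hf.periodic], by rwa [hf.periodic], ?_, ?_⟩
  · intro i hi hi'
    rw [← hper]
    exact h6 _ (by omega) (by omega)
  · intro i hi hi' hv
    rw [← hper] at hv
    have := h9 _ (by omega) (by omega) hv
    omega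
  · intro i hi hi' hv
    rw [← hper] at hv
    have := h10 _ (by omega) (by omega) hv
    omega

lemma reflect (h : HitSector G f c v a p q b) :
    HitSector G (fun i => f (-i)) c v (-b) (-q) (-p) (-a) := by
  obtain ⟨h1, h2, h3, h4, h5, h6, h7, h8, h9, h10⟩ := h
  refine ⟨by omega, by omega, by omega, by simpa, by simpa, ?_, by simpa, by simpa, ?_, ?_⟩
  · exact fun i hi hi' => h6 _ (by omega) (by omega)
  · intro i hi hi' hv
    have := h10 _ (by omega) (by omega) hv
    omega
  · intro i hi hi' hv
    have := h9 _ (by omega) (by omega) hv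
    omega

/-- If the neighbors of `v` in a sector do not form an edge, then `v` has no way of leaving
another sector through an end far from the first sector. -/
lemma theta_of_far_end (hf : CyclicHole G n f) (hcv : FarPair G f c v)
    (hth : ¬ ContainsTheta G) (h : HitSector G f c v a p q b)
    (h' : HitSector G f c v a' p' q' b') (hpq : q ≠ p + 1) (hq' : b + 2 ≤ q')
    (hb' : b' + 2 ≤ a + n) : False := by
  obtain ⟨h1, h2, h3, h4, h5, h6, h7, h8, h9, h10⟩ := h
  have hlt := h'.lt_end
  have hv' := h'.adj_last
  have hc' := h'.adj_end
  rcases h2.eq_or_lt with rfl | h2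
  · have hvn : ∀ i, a ≤ i → i ≤ b → i ≠ p → ¬ G.Adj v (f i) := by
      intro i hi hi' hne hv
      have := h9 i hi hi' hv
      have := h10 i hi hi' hv
      omega
    refine hth (containsTheta_of_linkedThrough (a := f p) (b := c) (A₁ := arc f a (p - 1))
      (A₂ := arc f (p + 1) b) (A₃ := insert v (arc f q' b')) (hcv.left_ne p).symm
      (fun hpc => h6 p h1 h3 hpc.symm) ?_ ?_ ?_ ?_ ?_ ?_)
    · exact hf.linkedThrough_arc (by omega) (Or.inr ⟨rfl, rfl⟩)
        (hf.adj_of_eq_add_one (by omega)).symm h4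
    · exact hf.linkedThrough_arc (by omega) (Or.inl ⟨rfl, rfl⟩) (hf.adj_succ p) h5
    · refine ⟨v, f b', h7.symm, Reaches.cons (by simp) hv' ?_, hc'.symm⟩
      exact (hf.reaches_arc (by omega)).mono (Set.subset_insert _ _)
    · exact hf.apart_arc (by omega) (by omega)
    · refine ((hf.apart_arc (by omega) (by omega)).symm.insert_left
        (CyclicHole.notMem_arc hcv.right_ne _ _) ?_).symm
      rintro _ ⟨i, ⟨hi, hi'⟩, rfl⟩
      exact hvn i (by omega) (by omega) (by omega)
    · refine ((hf.apart_arc (by omega) (by omega)).symm.insert_left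
        (CyclicHole.notMem_arc hcv.right_ne _ _) ?_).symm
      rintro _ ⟨i, ⟨hi, hi'⟩, rfl⟩
      exact hvn i (by omega) (by omega) (by omega)
  · refine hth (containsTheta_of_linkedThrough (a := v) (b := c) (A₁ := arc f a p)
      (A₂ := arc f q b) (A₃ := arc f q' b') hcv.ne hcv.not_adj ?_ ?_ ?_ ?_ ?_ ?_)
    · exact hf.linkedThrough_arc (by omega) (Or.inr ⟨rfl, rfl⟩) h7 h4
    · exact hf.linkedThrough_arc (by omega) (Or.inl ⟨rfl, rfl⟩) h8 h5
    · exact hf.linkedThrough_arc (by omega) (Or.inl ⟨rfl, rfl⟩) hv' hc'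
    · exact hf.apart_arc (by omega) (by omega)
    · exact hf.apart_arc (by omega) (by omega)
    · exact hf.apart_arc (by omega) (by omega)

lemma theta_of_far_start (hf : CyclicHole G n f) (hcv : FarPair G f c v)
    (hth : ¬ ContainsTheta G) (h : HitSector G f c v a p q b)
    (h' : HitSector G f c v a' p' q' b') (hpq : q ≠ p + 1) (ha' : b + 2 ≤ a')
    (hp' : p' + 2 ≤ a + n) : False :=
  theta_of_far_end hf.reflect hcv.reflect hth h.reflect (h'.reflect.shift hf.reflect)
    (by omega) (by omega) (by omega)

/-- Three sectors in which `v` has at least two neighbors each yield a theta. -/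
lemma theta_of_three (hf : CyclicHole G n f) (hcv : FarPair G f c v) (hth : ¬ ContainsTheta G)
    {a₁ p₁ q₁ b₁ a₂ p₂ q₂ b₂ a₃ p₃ q₃ b₃ : ℤ} (h₁ : HitSector G f c v a₁ p₁ q₁ b₁)
    (h₂ : HitSector G f c v a₂ p₂ q₂ b₂) (h₃ : HitSector G f c v a₃ p₃ q₃ b₃)
    (hpq₁ : p₁ < q₁) (hpq₂ : p₂ < q₂) (hpq₃ : p₃ < q₃) (h₁₂ : b₁ ≤ a₂) (h₂₃ : b₂ ≤ a₃)
    (h₃₁ : b₃ ≤ a₁ + n) : False := by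
  have := h₁.start_lt
  have := h₁.lt_end
  have := h₂.start_lt
  have := h₂.lt_end
  have := h₃.start_lt
  have := h₃.lt_end
  exact hth (containsTheta_of_linkedThrough (a := v) (b := c) (A₁ := arc f q₁ b₁)
    (A₂ := arc f q₂ b₂) (A₃ := arc f q₃ b₃) hcv.ne hcv.not_adj
    (hf.linkedThrough_arc (by omega) (Or.inl ⟨rfl, rfl⟩) h₁.adj_last h₁.adj_end)
    (hf.linkedThrough_arc (by omega) (Or.inl ⟨rfl, rfl⟩) h₂.adj_last h₂.adj_end)
    (hf.linkedThrough_arc (by omega) (Or.inl ⟨rfl, rfl⟩) h₃.adj_last h₃.adj_end)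
    (hf.apart_arc (by omega) (by omega)) (hf.apart_arc (by omega) (by omega))
    (hf.apart_arc (by omega) (by omega)))

end HitSector

lemma CyclicHole.periodic_mul {G : SimpleGraph V} {n : ℤ} {f : ℤ → V} (hf : CyclicHole G n f)
    (i m : ℤ) : f (i + m * n) = f i := by
  simpa using (show Function.Periodic f n from hf.periodic).int_mul m i

lemma CyclicHole.exists_index_mem_Ico {G : SimpleGraph V} {n : ℤ} {f : ℤ → V}
    (hf : CyclicHole G n f) (i a : ℤ) : ∃ j, a ≤ j ∧ j < a + n ∧ f j = f i := by
  have hn : 0 < n := by have := hf.four_le; omega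
  refine ⟨a + (i - a) % n, ?_, ?_, ?_⟩
  · have := Int.emod_nonneg (i - a) hn.ne'
    omega
  · have := Int.emod_lt_of_pos (i - a) hn
    omega
  · rw [← hf.periodic_mul _ ((i - a) / n)]
    congr 1
    have := Int.emod_add_mul_ediv (i - a) n
    rw [mul_comm] at this
    omega

lemma HitSector.exists_of_adj {G : SimpleGraph V} {n : ℤ} {f : ℤ → V} {c v : V}
    (hf : CyclicHole G n f) (hcv : FarPair G f c v) {k i : ℤ} (hk : G.Adj c (f k))
    (hi : G.Adj v (f i)) : ∃ a p q b, HitSector G f c v a p q b ∧ a < i ∧ i < b := by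
  have hci : ¬ G.Adj c (f i) := fun h => hcv.disjoint i h hi
  obtain ⟨l, -, hl, hfl⟩ := hf.exists_index_mem_Ico k (i - n)
  obtain ⟨m, hm, -, hfm⟩ := hf.exists_index_mem_Ico k i
  obtain ⟨a, ⟨hca, hai⟩, ha⟩ := Int.exists_greatest_of_bdd
    (P := fun z => G.Adj c (f z) ∧ z ≤ i) ⟨i, fun z hz => hz.2⟩ ⟨l, hfl ▸ hk, by omega⟩
  obtain ⟨b, ⟨hcb, hib⟩, hb⟩ := Int.exists_least_of_bdd
    (P := fun z => G.Adj c (f z) ∧ i ≤ z) ⟨i, fun z hz => hz.2⟩ ⟨m, hfm ▸ hk, hm⟩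
  obtain ⟨p, ⟨hvp, hap, hpb⟩, hp⟩ := Int.exists_least_of_bdd
    (P := fun z => G.Adj v (f z) ∧ a ≤ z ∧ z ≤ b) ⟨a, fun z hz => hz.2.1⟩ ⟨i, hi, hai, hib⟩
  obtain ⟨q, ⟨hvq, haq, hqb⟩, hq⟩ := Int.exists_greatest_of_bdd
    (P := fun z => G.Adj v (f z) ∧ a ≤ z ∧ z ≤ b) ⟨b, fun z hz => hz.2.2⟩ ⟨i, hi, hai, hib⟩
  have hne : ∀ x y, G.Adj c (f x) → G.Adj v (f y) → x ≠ y := by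
    rintro x _ hx hy rfl
    exact hcv.disjoint x hx hy
  have h1 := hne a p hca hvp
  have h2 := hne b q hcb hvq
  have h3 := hne a i hca hi
  have h4 := hne b i hcb hi
  refine ⟨a, p, q, b, ⟨by omega, (hp i ⟨hi, hai, hib⟩).trans (hq i ⟨hi, hai, hib⟩), by omega,
    hca, hcb, ?_, hvp, hvq, fun j hj hj' hv => hp j ⟨hv, hj, hj'⟩,
    fun j hj hj' hv => hq j ⟨hv, hj, hj'⟩⟩, by omega, by omega⟩
  intro j hj hj' hc
  rcases le_total j i with hji | hji
  · have := ha j ⟨hc, hji⟩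
    omega
  · have := hb j ⟨hc, hji⟩
    omega

/-- `c` is the center of a non-special wheel whose rim is enumerated by `f`. -/
structure NonSpecialCenter (G : SimpleGraph V) (n : ℤ) (f : ℤ → V) (c : V) : Prop where
  exists_third : ∀ a b, a < b → b < a + n → G.Adj c (f a) → G.Adj c (f b) →
    ∃ i, a < i ∧ i < a + n ∧ i ≠ b ∧ G.Adj c (f i)
  exists_fourth : ∀ a b, a + 3 ≤ b → b + 2 ≤ a + n → G.Adj c (f a) → G.Adj c (f (a + 1)) →
    G.Adj c (f b) → ∃ i, a < i ∧ i < a + n ∧ i ≠ a + 1 ∧ i ≠ b ∧ G.Adj c (f i)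

namespace HitSector

variable {G : SimpleGraph V} {n : ℤ} {f : ℤ → V} {c v : V} {a p q b a' p' q' b' : ℤ}

lemma not_both_ends_close (hf : CyclicHole G n f) (hcv : FarPair G f c v)
    (hpr : ¬ ContainsPrism G) (hc : NonSpecialCenter G n f c)
    (h : HitSector G f c v a p q b) (h' : HitSector G f c v a' p' q' b') (hb : b ≤ a')
    (hb' : b' ≤ a + n) (ha'b : a' ≤ b + 1) (hb'a : a + n ≤ b' + 1) : False := by
  have h1 := h.start_lt
  have h2 := h.le
  have h3 := h.lt_end
  have h1' := h'.start_lt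
  have h2' := h'.le
  have h3' := h'.lt_end
  have hN : ∀ i, b < i → i < b + n → i ≠ a' → i ≠ b' → i ≠ a + n → ¬ G.Adj c (f i) := by
    intro i hi hi' ha hb hn hci
    rcases lt_or_ge i b' with hib | hib
    · exact h'.not_adj i (by omega) hib hci
    · have : i - n + n = i := by omega
      rw [← this, hf.periodic] at hci
      exact h.not_adj (i - n) (by omega) (by omega) hci
  have ha := h.adj_start
  rw [← hf.periodic a] at ha
  rcases (show a' = b ∨ a' = b + 1 by omega) with rfl | rfl
  · rcases (show b' = a + n ∨ b' = a + n - 1 by omega) with rfl | rfl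
    · obtain ⟨i, hi, hi', hne, hci⟩ := hc.exists_third a' (a + n) (by omega) (by omega)
        h.adj_end ha
      exact hN i hi hi' (by omega) hne hne hci
    · obtain ⟨i, hi, hi', hne, hne', hci⟩ := hc.exists_fourth (a + n - 1) (a' + n) (by omega)
        (by omega) h'.adj_end (by rwa [sub_add_cancel]) (by rw [hf.periodic]; exact h.adj_end)
      rcases lt_or_ge i (a' + n) with hin | hin
      · exact hN i (by omega) hin (by omega) (by omega) (by omega) hci
      · have : i - n + n = i := by omega
        rw [← this, hf.periodic] at hci
        exact hN (i - n) (by omega) (by omega) (by omega) (by omega) (by omega) hci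
  · rcases (show b' = a + n ∨ b' = a + n - 1 by omega) with rfl | rfl
    · obtain ⟨i, hi, hi', hne, hne', hci⟩ := hc.exists_fourth b (a + n) (by omega) (by omega)
        h.adj_end h'.adj_start ha
      exact hN i hi hi' hne hne' hne' hci
    · obtain ⟨i, hi, hi', hne, hne', hne'', hci⟩ := hf.exists_fifth_neighbor hpr hcv.left_ne
        (i := b) (j := a + n - 1) (by omega) (by omega) h.adj_end h'.adj_start h'.adj_end
        (by rwa [sub_add_cancel])
      exact hN i hi hi' hne hne' (by omega) hci

/-- If the neighbors of `v` in a sector do not form an edge, then every other sector met by `v`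
shares an end with it, and the only neighbor of `v` there is the vertex next to that end. -/
lemma close_of_not_edge (hf : CyclicHole G n f) (hcv : FarPair G f c v)
    (hth : ¬ ContainsTheta G) (hpr : ¬ ContainsPrism G) (hc : NonSpecialCenter G n f c)
    (h : HitSector G f c v a p q b) (h' : HitSector G f c v a' p' q' b') (hb : b ≤ a')
    (hb' : b' ≤ a + n) (hpq : q ≠ p + 1) :
    (a' = b ∧ q' = b + 1 ∧ b' + 2 ≤ a + n) ∨ (b' = a + n ∧ p' + 1 = a + n ∧ b + 2 ≤ a') := by
  have h1' := h'.start_lt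
  have h2' := h'.le
  have h3' := h'.lt_end
  have k1 : ¬ (a' ≤ b + 1 ∧ a + n ≤ b' + 1) := fun k =>
    not_both_ends_close hf hcv hpr hc h h' hb hb' k.1 k.2
  have k2 : ¬ (b + 2 ≤ q' ∧ b' + 2 ≤ a + n) := fun k =>
    theta_of_far_end hf hcv hth h h' hpq k.1 k.2
  have k3 : ¬ (b + 2 ≤ a' ∧ p' + 2 ≤ a + n) := fun k =>
    theta_of_far_start hf hcv hth h h' hpq k.1 k.2
  omega

lemma false_of_shared_end (hf : CyclicHole G n f) (hcv : FarPair G f c v) (hn : n ≠ 6)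
    (hth : ¬ ContainsTheta G) (hpr : ¬ ContainsPrism G) (hc : NonSpecialCenter G n f c)
    (h : HitSector G f c v a p q b) (h' : HitSector G f c v b p' (b + 1) b')
    (hb' : b' + 2 ≤ a + n) (hpq : q ≠ p + 1) : False := by
  have h1 := h.start_lt
  have h2 := h.le
  have h3 := h.lt_end
  have h1' := h'.start_lt
  have h2' := h'.le
  have h3' := h'.lt_end
  have k := close_of_not_edge hf hcv hth hpr hc h' (h.shift hf) (by omega) (by omega) (by omega)
  obtain rfl : p = b - 1 := by omega
  obtain rfl : q = b - 1 := by omega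
  obtain ⟨i, hi, hi', hne, hvi⟩ := hf.exists_third_neighbor hth hcv.right_ne (i := b - 1)
    (j := b + 1) (by omega) (by omega) h.adj_last h'.adj_last
  obtain ⟨a'', p'', q'', b'', h'', ha'', hb''⟩ := exists_of_adj hf hcv h.adj_end hvi
  have h1'' := h''.start_lt
  have h2'' := h''.le
  have h3'' := h''.lt_end
  have hbi : i ≠ b := by
    rintro rfl
    exact hcv.disjoint _ h.adj_end hvi
  have hb'i : b' < i := by
    by_contra hle
    have := h'.le_last i (by omega) (by omega) hvi
    omega
  have hia : i < a + n := by
    by_contra hle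
    rw [← sub_add_cancel i n, hf.periodic] at hvi
    have := h.first_le (i - n) (by omega) (by omega) hvi
    omega
  have hb'a : b' ≤ a'' := by
    by_contra hlt
    exact h''.not_adj b' (by omega) (by omega) h'.adj_end
  have hb''a : b'' ≤ a + n := by
    by_contra hlt
    refine h''.not_adj (a + n) (by omega) (by omega) ?_
    rw [hf.periodic]
    exact h.adj_start
  have k1 := close_of_not_edge hf hcv hth hpr hc h h'' (by omega) (by omega) (by omega)
  have k2 := close_of_not_edge hf hcv hth hpr hc h' h'' (by omega) (by omega) (by omega)
  have k3 := close_of_not_edge hf hcv hth hpr hc h'' (h.shift hf) (by omega) (by omega)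
    (by omega)
  have k4 := close_of_not_edge hf hcv hth hpr hc h'' (h'.shift hf) (by omega) (by omega)
    (by omega)
  omega

lemma edge_of_two (hf : CyclicHole G n f) (hcv : FarPair G f c v) (hn : n ≠ 6)
    (hth : ¬ ContainsTheta G) (hpr : ¬ ContainsPrism G) (hc : NonSpecialCenter G n f c)
    (h : HitSector G f c v a p q b) (h' : HitSector G f c v a' p' q' b') (hb : b ≤ a')
    (hb' : b' ≤ a + n) : q = p + 1 := by
  by_contra hpq
  have h1 := h.start_lt
  have h2 := h.le
  have h3 := h.lt_end
  have h1' := h'.start_lt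
  have h2' := h'.le
  have h3' := h'.lt_end
  rcases close_of_not_edge hf hcv hth hpr hc h h' hb hb' hpq with ⟨rfl, rfl, h4⟩ | ⟨rfl, h4, h5⟩
  · exact false_of_shared_end hf hcv hn hth hpr hc h h' h4 hpq
  · have hs := h.shift hf
    have k := close_of_not_edge hf hcv hth hpr hc h' hs (by omega) (by omega) (by omega)
    obtain hq : q + n = a + n + 1 := by omega
    rw [hq] at hs
    exact false_of_shared_end hf hcv hn hth hpr hc h' hs (by omega) (by omega)

/-- In a (theta, prism)-free graph, a vertex as in `FarPair` does not meet the interiors of two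
sectors of a non-special wheel whose rim does not have length six. -/
theorem false_of_two (hf : CyclicHole G n f) (hcv : FarPair G f c v) (hn : n ≠ 6)
    (hth : ¬ ContainsTheta G) (hpr : ¬ ContainsPrism G) (hc : NonSpecialCenter G n f c)
    (h : HitSector G f c v a p q b) (h' : HitSector G f c v a' p' q' b') (hb : b ≤ a')
    (hb' : b' ≤ a + n) : False := by
  have h1 := h.start_lt
  have h3 := h.lt_end
  have h1' := h'.start_lt
  have h3' := h'.lt_end
  obtain rfl := edge_of_two hf hcv hn hth hpr hc h h' hb hb'
  obtain rfl := edge_of_two hf hcv hn hth hpr hc h' (h.shift hf) hb' (by omega)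
  obtain ⟨i, hi, hi', hne, hne', hne'', hvi⟩ := hf.exists_fifth_neighbor hpr hcv.right_ne
    (i := p) (j := p') (by omega) (by omega) h.adj_first h.adj_last h'.adj_first h'.adj_last
  obtain ⟨a'', p'', q'', b'', h'', ha'', hb''⟩ := exists_of_adj hf hcv h.adj_end hvi
  have h1'' := h''.start_lt
  have h2'' := h''.le
  have h3'' := h''.lt_end
  have hna : G.Adj c (f (a + n)) := by
    rw [hf.periodic]
    exact h.adj_start
  have hout : b < i ∧ i < a' ∨ b' < i ∧ i < a + n := by
    have n1 : ¬ i ≤ b := fun hle => by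
      have := h.le_last i (by omega) hle hvi
      omega
    have n2 : ¬ (a' ≤ i ∧ i ≤ b') := fun hle => by
      have := h'.le_last i hle.1 hle.2 hvi
      have := h'.first_le i hle.1 hle.2 hvi
      omega
    have n3 : ¬ a + n ≤ i := fun hle => by
      rw [← sub_add_cancel i n, hf.periodic] at hvi
      have := h.first_le (i - n) (by omega) (by omega) hvi
      omega
    omega
  rcases hout with ⟨hbi, hia⟩ | ⟨hbi, hia⟩
  · have e1 : b ≤ a'' := by
      by_contra hlt
      exact h''.not_adj b (by omega) (by omega) h.adj_end
    have e2 : b'' ≤ a' := by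
      by_contra hlt
      exact h''.not_adj a' (by omega) (by omega) h'.adj_start
    have := edge_of_two hf hcv hn hth hpr hc h'' h' e2 (by omega)
    exact theta_of_three hf hcv hth h h'' h' (by omega) (by omega) (by omega) e1 e2 hb'
  · have e1 : b' ≤ a'' := by
      by_contra hlt
      exact h''.not_adj b' (by omega) (by omega) h'.adj_end
    have e2 : b'' ≤ a + n := by
      by_contra hlt
      exact h''.not_adj (a + n) (by omega) (by omega) hna
    have := edge_of_two hf hcv hn hth hpr hc h'' (h.shift hf) e2 (by omega)
    exact theta_of_three hf hcv hth h h' h'' (by omega) (by omega) (by omega) hb e1 e2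

end HitSector

lemma CyclicHole.exists_path_arc {G : SimpleGraph V} {n : ℤ} {f : ℤ → V}
    (hf : CyclicHole G n f) (d : ℕ) (hd : d < n) (a b : ℤ) (hab : b = a + d) :
    ∃ p : G.Walk (f a) (f b), p.IsPath ∧ ∀ w, w ∈ p.support ↔ w ∈ arc f a b := by
  induction d generalizing a with
  | zero =>
    obtain rfl : b = a := by simpa using hab
    exact ⟨Walk.nil, Walk.IsPath.nil, fun w => by simp [arc]⟩
  | succ d ih =>
    push_cast at hd hab
    obtain ⟨p, hp, hs⟩ := ih (by omega) (a + 1) (by omega)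
    refine ⟨Walk.cons (hf.adj_succ a) p, ?_, fun w => ?_⟩
    · rw [Walk.cons_isPath_iff, hs]
      refine ⟨hp, ?_⟩
      rintro ⟨i, ⟨hi, hi'⟩, hia⟩
      exact hf.ne a i (by omega) (by omega) hia.symm
    · rw [Walk.support_cons, List.mem_cons, hs]
      constructor
      · rintro (rfl | ⟨i, ⟨hi, hi'⟩, rfl⟩)
        · exact mem_arc le_rfl (by omega)
        · exact mem_arc (by omega) hi'
      · rintro ⟨i, ⟨hi, hi'⟩, rfl⟩
        rcases hi.eq_or_lt with rfl | hlt
        · exact Or.inl rfl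
        · exact Or.inr (mem_arc (by omega) hi')

/-- The periodic enumeration of the vertices of a closed walk. -/
def cyclicVert {G : SimpleGraph V} {h : V} (H : G.Walk h h) (i : ℤ) : V :=
  H.getVert (i % H.length).toNat

lemma IsHoleWalk.getVert_inj {G : SimpleGraph V} {h : V} {H : G.Walk h h}
    (hH : IsHoleWalk G H) {x y : ℕ} (hx : x < H.length) (hy : y < H.length)
    (hxy : H.getVert x = H.getVert y) : x = y :=
  hH.1.getVert_injOn' (show x ≤ H.length - 1 by omega) (show y ≤ H.length - 1 by omega) hxy

lemma IsHoleWalk.adj_getVert_iff {G : SimpleGraph V} {h : V} {H : G.Walk h h}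
    (hH : IsHoleWalk G H) {x y : ℕ} (hx : x < H.length) (hy : y < H.length) :
    G.Adj (H.getVert x) (H.getVert y) ↔
      y = x + 1 ∨ x = y + 1 ∨ (x = 0 ∧ y + 1 = H.length) ∨ (y = 0 ∧ x + 1 = H.length) := by
  have hlast : H.getVert H.length = H.getVert 0 := H.getVert_length.trans H.getVert_zero.symm
  have hend : ∀ z, z + 1 = H.length → G.Adj (H.getVert z) (H.getVert 0) := by
    intro z hz
    have := H.adj_getVert_succ (i := z) (by omega)
    rwa [hz, hlast] at this
  constructor
  · intro hadj
    have hmem := hH.2.2 _ (H.getVert_mem_support x) _ (H.getVert_mem_support y) hadj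
    rw [← Walk.adj_toSubgraph_iff_mem_edges, Walk.toSubgraph_adj_iff] at hmem
    obtain ⟨i, hi, hil⟩ := hmem
    have key : ∀ u w : ℕ, u < H.length → w < H.length → H.getVert i = H.getVert u →
        H.getVert (i + 1) = H.getVert w → w = u + 1 ∨ (w = 0 ∧ u + 1 = H.length) := by
      intro u w hu hw h1 h2
      obtain rfl := hH.getVert_inj hil hu h1
      rcases (show i + 1 < H.length ∨ i + 1 = H.length by omega) with h3 | h3
      · exact Or.inl (hH.getVert_inj h3 hw h2).symm
      · rw [h3, hlast] at h2
        exact Or.inr ⟨(hH.getVert_inj (by omega) hw h2).symm, h3⟩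
    rcases Sym2.eq_iff.1 hi with ⟨h1, h2⟩ | ⟨h1, h2⟩
    · have := key x y hx hy h1 h2
      tauto
    · have := key y x hy hx h1 h2
      tauto
  · rintro (rfl | rfl | ⟨rfl, h1⟩ | ⟨rfl, h1⟩)
    · exact H.adj_getVert_succ hx
    · exact (H.adj_getVert_succ hy).symm
    · exact (hend y h1).symm
    · exact hend x h1

lemma IsHoleWalk.cyclicHole {G : SimpleGraph V} {h : V} {H : G.Walk h h}
    (hH : IsHoleWalk G H) : CyclicHole G H.length (cyclicVert H) := by
  have hn : (4 : ℤ) ≤ H.length := by exact_mod_cast hH.2.1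
  have hmod : ∀ i j : ℤ, i < j → j < i + H.length → ∃ x y : ℕ, x < H.length ∧ y < H.length ∧
      cyclicVert H i = H.getVert x ∧ cyclicVert H j = H.getVert y ∧
      ((y : ℤ) = x + (j - i) ∨ (y : ℤ) = x + (j - i) - H.length) := by
    intro i j hij hji
    have h1 := Int.emod_nonneg i (b := H.length) (by omega)
    have h2 := Int.emod_lt_of_pos i (b := H.length) (by omega)
    have h3 := Int.emod_nonneg j (b := H.length) (by omega)
    have h4 := Int.emod_lt_of_pos j (b := H.length) (by omega)
    refine ⟨(i % H.length).toNat, (j % H.length).toNat, by omega, by omega, rfl, rfl, ?_⟩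
    have h5 : j % H.length = (i % H.length + (j - i)) % H.length := by
      rw [Int.emod_add_emod]
      congr 1
      ring
    rw [Int.toNat_of_nonneg h1, Int.toNat_of_nonneg h3]
    rcases lt_or_ge (i % H.length + (j - i)) H.length with h6 | h6
    · left
      rw [h5, Int.emod_eq_of_lt (by omega) h6]
    · right
      rw [h5, ← Int.sub_emod_right, Int.emod_eq_of_lt (by omega) (by omega)]
  refine ⟨hn, fun i => by simp [cyclicVert], fun i j hij hji heq => ?_, fun i j hij hji => ?_⟩
  · obtain ⟨x, y, hx, hy, h1, h2, h3⟩ := hmod i j hij hji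
    rw [h1, h2] at heq
    have := hH.getVert_inj hx hy heq
    omega
  · obtain ⟨x, y, hx, hy, h1, h2, h3⟩ := hmod i j hij hji
    rw [h1, h2, hH.adj_getVert_iff hx hy]
    omega

lemma cyclicVert_mem_support {G : SimpleGraph V} {h : V} (H : G.Walk h h) (i : ℤ) :
    cyclicVert H i ∈ H.support :=
  H.getVert_mem_support _

lemma IsHoleWalk.exists_index {G : SimpleGraph V} {h : V} {H : G.Walk h h}
    (hH : IsHoleWalk G H) {w : V} (hw : w ∈ H.support) (a : ℤ) :
    ∃ i, a ≤ i ∧ i < a + H.length ∧ cyclicVert H i = w := by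
  obtain ⟨k, rfl, hk⟩ := Walk.mem_support_iff_exists_getVert.1 hw
  have : cyclicVert H k = H.getVert k := by
    rcases hk.lt_or_eq with hk | rfl
    · rw [cyclicVert, Int.emod_eq_of_lt (by omega) (by omega), Int.toNat_natCast]
    · rw [cyclicVert, Int.emod_self, H.getVert_length, Int.toNat_zero, H.getVert_zero]
  rw [← this]
  exact hH.cyclicHole.exists_index_mem_Ico _ a

lemma IsWheel.exists_other {G : SimpleGraph V} {h : V} {H : G.Walk h h} {c : V}
    (hW : IsWheel G H c) (a b : ℤ) :
    ∃ i, a < i ∧ i < a + H.length ∧ i ≠ b ∧ G.Adj c (cyclicVert H i) := by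
  by_contra! hno
  have hsub : HoleNbrs G H c ⊆ {cyclicVert H a, cyclicVert H b} := by
    rintro w ⟨hw, hcw⟩
    obtain ⟨i, hi, hi', rfl⟩ := hW.1.exists_index hw a
    by_contra hne
    simp only [Set.mem_insert_iff, Set.mem_singleton_iff, not_or] at hne
    have hia : i ≠ a := fun h => hne.1 (by rw [h])
    exact hno i (by omega) hi' (fun h => hne.2 (by rw [h])) hcw
  have h1 := Set.ncard_le_ncard hsub (Set.toFinite _)
  have h2 := Set.ncard_insert_le (cyclicVert H a) {cyclicVert H b}
  rw [Set.ncard_singleton] at h2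
  have h3 := hW.2.2
  omega

lemma IsWheel.nonSpecialCenter {G : SimpleGraph V} {h : V} {H : G.Walk h h} {c : V}
    (hW : IsWheel G H c) (hns : ¬ IsSpecialWheel G H c) :
    NonSpecialCenter G H.length (cyclicVert H) c := by
  have hf := hW.1.cyclicHole
  refine ⟨fun a b _ _ _ _ => hW.exists_other a b, fun a b hab hba ha ha' hb => ?_⟩
  by_contra! hno
  refine hns ⟨hW, cyclicVert H a, cyclicVert H (a + 1), cyclicVert H b,
    hf.ne _ _ (by omega) (by omega), hf.ne _ _ (by omega) (by omega),
    hf.ne _ _ (by omega) (by omega), ?_, ?_, ?_, ?_⟩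
  · ext w
    constructor
    · rintro ⟨hw, hcw⟩
      obtain ⟨i, hi, hi', rfl⟩ := hW.1.exists_index hw a
      by_contra hne
      simp only [Set.mem_insert_iff, Set.mem_singleton_iff, not_or] at hne
      have hia : i ≠ a := fun h => hne.1 (by rw [h])
      exact hno i (by omega) hi' (fun h => hne.2.1 (by rw [h])) (fun h => hne.2.2 (by rw [h])) hcw
    · rintro (rfl | rfl | rfl)
      exacts [⟨cyclicVert_mem_support H _, ha⟩, ⟨cyclicVert_mem_support H _, ha'⟩,
        ⟨cyclicVert_mem_support H _, hb⟩]
  · exact hW.1.2.2 _ (cyclicVert_mem_support H _) _ (cyclicVert_mem_support H _) (hf.adj_succ a)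
  · exact fun he => hf.not_adj (by omega) hba (Walk.adj_of_mem_edges _ he)
  · exact fun he => hf.not_adj (by omega) (by omega) (Walk.adj_of_mem_edges _ he)

lemma IsWheel.exists_isSector {G : SimpleGraph V} {h : V} {H : G.Walk h h} {c : V}
    (hW : IsWheel G H c) {a b : ℤ} (hab : a < b) (ha : G.Adj c (cyclicVert H a))
    (hb : G.Adj c (cyclicVert H b))
    (hno : ∀ i, a < i → i < b → ¬ G.Adj c (cyclicVert H i)) :
    b < a + H.length ∧ ∃ p : G.Walk (cyclicVert H a) (cyclicVert H b), IsSector G H c p ∧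
      ∀ w, w ∈ p.support ↔ w ∈ arc (cyclicVert H) a b := by
  have hf := hW.1.cyclicHole
  have hba : b < a + H.length := by
    obtain ⟨i, hi, hi', -, hci⟩ := hW.exists_other a a
    by_contra hlt
    exact hno i hi (by omega) hci
  obtain ⟨p, hp, hs⟩ := hf.exists_path_arc (b - a).toNat (by omega) a b (by omega)
  have hsub : ∀ w ∈ p.support, w ∈ H.support := by
    intro w hw
    obtain ⟨i, -, rfl⟩ := (hs w).1 hw
    exact cyclicVert_mem_support H i
  refine ⟨hba, p, ⟨hp, ?_, hsub, ?_, ha, hb, ?_⟩, hs⟩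
  · rw [Nat.pos_iff_ne_zero]
    exact fun h0 => hf.ne a b hab hba (Walk.eq_of_length_eq_zero h0)
  · intro e he
    induction e with
    | _ x y =>
      exact hW.1.2.2 _ (hsub _ (p.fst_mem_support_of_mem_edges he)) _
        (hsub _ (p.snd_mem_support_of_mem_edges he)) (p.adj_of_mem_edges he)
  · intro w hw hwa hwb
    obtain ⟨i, ⟨hi, hi'⟩, rfl⟩ := (hs w).1 hw
    have hia : i ≠ a := fun h => hwa (by rw [h])
    have hib : i ≠ b := fun h => hwb (by rw [h])
    exact hno i (by omega) (by omega)

/-- claim (2) in the proof of Theorem 3.1. -/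
theorem statement_5 {V : Type} [Fintype V] (G : SimpleGraph V)
    (hth : ¬ ContainsTheta G) (hpr : ¬ ContainsPrism G)
    {h : V} (H : G.Walk h h) (c : V)
    (hW : IsWheel G H c) (hns : ¬ IsSpecialWheel G H c) (hlen : 7 ≤ H.length)
    (v : V) (hvH : v ∉ H.support) (hvc : v ≠ c)
    (hvT : v ∉ ClosedNbhd G {c} ∪
      (ClosedNbhd G (HoleNbrs G H c) \ {w | w ∈ H.support})) :
    ∃ (x y : V) (P : G.Walk x y), IsSector G H c P ∧
      ∀ u ∈ H.support, G.Adj v u → u ∈ P.support := by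
  have hf := hW.1.cyclicHole
  have hmem := cyclicVert_mem_support H
  have hvc' : ¬ G.Adj v c := fun hadj => hvT (Or.inl (Or.inr ⟨c, rfl, hadj⟩))
  have hcv : FarPair G (cyclicVert H) c v :=
    ⟨hvc, hvc', fun i hi => hW.2.1 (hi ▸ hmem i), fun i hi => hvH (hi ▸ hmem i),
      fun i hci hvi => hvT (Or.inr ⟨Or.inr ⟨_, ⟨hmem i, hci⟩, hvi⟩, hvH⟩)⟩
  obtain ⟨k, -, -, -, hk⟩ := hW.exists_other 0 0
  by_cases hv : ∃ i, G.Adj v (cyclicVert H i)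
  · obtain ⟨i, hi⟩ := hv
    obtain ⟨a, p, q, b, hs, hai, hib⟩ := HitSector.exists_of_adj hf hcv hk hi
    obtain ⟨hba, P, hP, hPs⟩ :=
      hW.exists_isSector (hai.trans hib) hs.adj_start hs.adj_end hs.not_adj
    refine ⟨_, _, P, hP, fun u hu hvu => (hPs u).2 ?_⟩
    obtain ⟨j, hj, hj', rfl⟩ := hW.1.exists_index hu a
    by_contra hout
    have hbj : b < j := by
      by_contra hle
      exact hout (mem_arc hj (by omega))
    obtain ⟨a', p', q', b', hs', haj', hjb'⟩ := HitSector.exists_of_adj hf hcv hk hvu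
    have hba' : b ≤ a' := by
      by_contra hlt
      exact hs'.not_adj b (by omega) (by omega) hs.adj_end
    have hb'a : b' ≤ a + H.length := by
      by_contra hlt
      refine hs'.not_adj (a + H.length) (by omega) (by omega) ?_
      rw [hf.periodic]
      exact hs.adj_start
    exact HitSector.false_of_two hf hcv (by omega) hth hpr (hW.nonSpecialCenter hns) hs hs'
      hba' hb'a
  · obtain ⟨m, hm, -, -, hcm⟩ := hW.exists_other k k
    obtain ⟨b, ⟨hkb, hcb⟩, hb⟩ := Int.exists_least_of_bdd
      (P := fun z => k < z ∧ G.Adj c (cyclicVert H z)) ⟨k, fun z hz => hz.1.le⟩ ⟨m, hm, hcm⟩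
    obtain ⟨-, P, hP, -⟩ := hW.exists_isSector hkb hk hcb fun i hi hi' hci => by
      have := hb i ⟨hi, hci⟩
      omega
    refine ⟨_, _, P, hP, fun u hu hvu => ?_⟩
    obtain ⟨i, -, -, rfl⟩ := hW.1.exists_index hu 0
    exact (hv ⟨i, hvu⟩).elim

end Paper
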